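/- The only pairs of rational numbers (u, v) satisfying v² + 5u³ + 5u² + 4 = 0 are (u, v) = (−2, 4) and (u, v) = (−2, −4). (Equivalently, the Mordell–Weil group of the elliptic curve 50.a3 over ℚ consists of the point at infinity and the two points (−2, ±4), so it has order 3.) -/

import Mathlib

/-- The ring `ℤ[ω]` of Eisenstein integers, with `ω² = -1 - ω`. -/
abbrev EisensteinInt : Type := QuadraticAlgebra ℤ (-1) (-1)

namespace EisensteinInt

open QuadraticAlgebra

theorem norm_eq (z : EisensteinInt) : z.norm = z.re ^ 2 - z.re * z.im + z.im ^ 2 := by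
  rw [norm_def]; ring

theorem norm_nonneg (z : EisensteinInt) : 0 ≤ z.norm := by
  rw [norm_eq]; nlinarith [sq_nonneg (z.re - z.im), sq_nonneg z.re, sq_nonneg z.im]

theorem norm_pos {z : EisensteinInt} (hz : z ≠ 0) : 0 < z.norm := by
  refine (norm_nonneg z).lt_of_ne' fun h ↦ hz ?_
  rw [norm_eq] at h
  have hre : z.re ^ 2 = 0 := by nlinarith [sq_nonneg (z.re - 2 * z.im), sq_nonneg z.re]
  have him : z.im ^ 2 = 0 := by nlinarith [sq_nonneg (2 * z.re - z.im), sq_nonneg z.im]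
  ext
  · simpa using hre
  · simpa using him

theorem two_mul_abs_sub_mul_div_le {m : ℤ} (hm : 0 < m) (k : ℤ) :
    |2 * (k - m * ((2 * k + m) / (2 * m)))| ≤ m := by
  have h₁ := Int.emod_add_mul_ediv (2 * k + m) (2 * m)
  have h₂ := Int.emod_nonneg (2 * k + m) (by positivity : 2 * m ≠ 0)
  have h₃ := Int.emod_lt_of_pos (2 * k + m) (by positivity : 0 < 2 * m)
  rw [abs_le]
  constructor <;> linarith

/-- Division in `ℤ[ω]`, rounding both coordinates of the exact quotient to a nearest integer. -/
def quot (x y : EisensteinInt) : EisensteinInt :=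
  ⟨(2 * (x * star y).re + y.norm) / (2 * y.norm), (2 * (x * star y).im + y.norm) / (2 * y.norm)⟩

theorem norm_sub_mul_quot_lt (x : EisensteinInt) {y : EisensteinInt} (hy : y ≠ 0) :
    (x - y * quot x y).norm < y.norm := by
  have hpos := norm_pos hy
  have hre := abs_le.1 (two_mul_abs_sub_mul_div_le hpos (x * star y).re)
  have him := abs_le.1 (two_mul_abs_sub_mul_div_le hpos (x * star y).im)
  have key : (x - y * quot x y).norm * y.norm =
      ((x * star y).re - y.norm * (quot x y).re) ^ 2
        - ((x * star y).re - y.norm * (quot x y).re) * ((x * star y).im - y.norm * (quot x y).im)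
        + ((x * star y).im - y.norm * (quot x y).im) ^ 2 := by
    simp only [norm_eq, re_sub, im_sub, re_mul, im_mul, re_star, im_star]
    ring
  change _ ≤ 2 * ((x * star y).re - y.norm * (quot x y).re) ∧
    2 * ((x * star y).re - y.norm * (quot x y).re) ≤ _ at hre
  change _ ≤ 2 * ((x * star y).im - y.norm * (quot x y).im) ∧
    2 * ((x * star y).im - y.norm * (quot x y).im) ≤ _ at him
  generalize (x * star y).re - y.norm * (quot x y).re = e at *
  generalize (x * star y).im - y.norm * (quot x y).im = f at *
  nlinarith [mul_nonneg (sub_nonneg.2 hre.1) (sub_nonneg.2 hre.2), sq_nonneg (e + f),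
    mul_nonneg (sub_nonneg.2 him.1) (sub_nonneg.2 him.2), sq_nonneg (e - f)]

instance : EuclideanDomain EisensteinInt where
  __ := (inferInstance : CommRing EisensteinInt)
  __ := (inferInstance : Nontrivial EisensteinInt)
  quotient := quot
  quotient_zero x := by simp [quot]; rfl
  remainder x y := x - y * quot x y
  quotient_mul_add_remainder_eq x y := by ring
  r x y := x.norm.natAbs < y.norm.natAbs
  r_wellFounded := (measure fun z : EisensteinInt ↦ z.norm.natAbs).wf
  remainder_lt x y hy := by
    have := norm_sub_mul_quot_lt x hy
    have := norm_nonneg (x - y * quot x y)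
    omega
  mul_left_not_lt x y hy := by
    rw [map_mul, Int.natAbs_mul, not_lt]
    exact Nat.le_mul_of_pos_right _ (Int.natAbs_pos.2 (norm_pos hy).ne')

theorem eq_of_norm_eq_one {z : EisensteinInt} (hz : z.norm = 1) :
    z = 1 ∨ z = -1 ∨ z = ω ∨ z = -ω ∨ z = ω ^ 2 ∨ z = -ω ^ 2 := by
  rw [norm_eq] at hz
  obtain ⟨a, b⟩ := z
  simp only at hz
  have ha : a ≤ 1 := by nlinarith [sq_nonneg (a - 2 * b)]
  have ha' : -1 ≤ a := by nlinarith [sq_nonneg (a - 2 * b)]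
  have hb : b ≤ 1 := by nlinarith [sq_nonneg (2 * a - b)]
  have hb' : -1 ≤ b := by nlinarith [sq_nonneg (2 * a - b)]
  interval_cases a <;> interval_cases b <;> first | (exfalso; omega) | decide

/-- If `p + qω` is coprime to its conjugate and its norm is a cube, then it is `1`, `ω` or `ω²`
times the cube of some `a + bω`. -/
theorem exists_cube {p q n : ℤ} (hpq : IsCoprime p q) (hn : ¬ 3 ∣ n)
    (h : p ^ 2 - p * q + q ^ 2 = n ^ 3) :
    ∃ a b : ℤ, a ^ 2 - a * b + b ^ 2 = n ∧
      ((p = a ^ 3 + b ^ 3 - 3 * a * b ^ 2 ∧ q = 3 * a * b * (a - b)) ∨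
       (p = -(3 * a * b * (a - b)) ∧ q = a ^ 3 + b ^ 3 - 3 * a * b ^ 2 - 3 * a * b * (a - b)) ∨
       (p = 3 * a * b * (a - b) - (a ^ 3 + b ^ 3 - 3 * a * b ^ 2) ∧
        q = -(a ^ 3 + b ^ 3 - 3 * a * b ^ 2))) := by
  let z : EisensteinInt := ⟨p, q⟩
  have hmul : z * star z = (n : EisensteinInt) ^ 3 := by
    rw [← Int.cast_pow, ← h]
    ext
    · simp only [re_mul, re_star, im_star, re_intCast, z, Int.cast_id]; ring
    · simp only [im_mul, re_star, im_star, im_intCast, z]; ring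
  have hcop : IsCoprime z (star z) := by
    obtain ⟨s, t, hst⟩ := hpq
    have h3n : IsCoprime 3 (n ^ 3) :=
      ((Int.prime_three.coprime_iff_not_dvd).2 hn).pow_right
    obtain ⟨c, d, hcd⟩ := h3n
    refine ⟨⟨c * (s - t), c * (-s - 2 * t)⟩ + (d : EisensteinInt) * star z,
      ⟨c * (2 * s + t), c * (s + 2 * t)⟩, ?_⟩
    ext
    · simp [z]
      linear_combination 3 * c * hst + hcd + d * h
    · simp [z]
      ring
  obtain ⟨y, hy⟩ : ∃ y, z = y ^ 3 ∨ z = y ^ 3 * ω ∨ z = y ^ 3 * ω ^ 2 := by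
    obtain ⟨y, u, hu⟩ := exists_associated_pow_of_mul_eq_pow' hcop hmul
    have hunit : (u : EisensteinInt).norm = 1 := by
      have := isUnit_iff_norm_isUnit.1 u.isUnit
      have := norm_nonneg (u : EisensteinInt)
      rcases Int.isUnit_iff.1 ‹IsUnit _› with h | h <;> omega
    rcases eq_of_norm_eq_one hunit with h | h | h | h | h | h <;> rw [h] at hu
    · exact ⟨y, .inl (by rw [← hu]; ring)⟩
    · exact ⟨-y, .inl (by rw [← hu]; ring)⟩
    · exact ⟨y, .inr (.inl (by rw [← hu]))⟩
    · exact ⟨-y, .inr (.inl (by rw [← hu]; ring))⟩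
    · exact ⟨y, .inr (.inr (by rw [← hu]))⟩
    · exact ⟨-y, .inr (.inr (by rw [← hu]; ring))⟩
  have hz : z.norm = n ^ 3 := by rw [norm_eq, ← h]
  have hω : (ω : EisensteinInt).norm = 1 := by decide
  have hyn : y.norm = n := by
    refine (Odd.strictMono_pow (by decide : Odd 3)).injective ?_
    rw [← hz]
    rcases hy with hy | hy | hy <;> simp [hy, hω]
  refine ⟨y.re, y.im, by rw [← hyn, norm_eq], ?_⟩
  have hp : p = z.re := rfl
  have hq : q = z.im := rfl
  rw [hp, hq]
  refine hy.imp ?_ (Or.imp ?_ ?_) <;> intro hy <;> rw [hy] <;> constructor <;>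
    simp [pow_succ] <;> ring

end EisensteinInt

namespace Curve50a3

theorem pow_three_injective : Function.Injective fun x : ℤ ↦ x ^ 3 :=
  (Odd.strictMono_pow (by decide : Odd 3)).injective

theorem isCoprime_of_add_eq {A B C R : ℤ} (hR : R ≠ 0) (hsum : A + B + C = 5 * R)
    (hprod : A * B * C = 5 * R ^ 3) (hprime : ∀ p : ℤ, Prime p → p ∣ A → p ∣ B → ¬ p ∣ R) :
    IsCoprime A B := by
  refine isCoprime_of_prime_dvd ?_ fun p hp hA hB ↦ ?_
  · rintro ⟨rfl, rfl⟩
    simp [hR] at hprod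
  have h5 : Prime (5 : ℤ) := by norm_num
  have hdvd : p ∣ 5 * R ^ 3 := hprod ▸ (hA.mul_right B).mul_right C
  rcases hp.dvd_or_dvd hdvd with h | h
  · have hassoc := hp.associated_of_dvd h5 h
    obtain ⟨a, rfl⟩ := hassoc.dvd_iff_dvd_left.1 hA
    obtain ⟨b, rfl⟩ := hassoc.dvd_iff_dvd_left.1 hB
    refine hprime 5 h5 (dvd_mul_right _ _) (dvd_mul_right _ _) (h5.dvd_of_dvd_pow (n := 3) ?_)
    refine ⟨5 * a * b * (R - a - b), ?_⟩
    have hC : C = 5 * (R - a - b) := by linarith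
    rw [hC] at hprod
    linarith
  · exact hprime p hp hA hB (hp.dvd_of_dvd_pow h)

theorem exists_cubic_of_five_dvd {A B C R : ℤ} (hR : R ≠ 0) (hsum : A + B + C = 5 * R)
    (hprod : A * B * C = 5 * R ^ 3) (hAB : IsCoprime A B) (hAC : IsCoprime A C)
    (hBC : IsCoprime B C) (hA : 5 ∣ A) :
    ∃ X Y Z : ℤ, IsCoprime X Y ∧ Z ≠ 0 ∧ X * Y * Z ∣ R ∧
      X ^ 3 + Y ^ 3 + 5 * X * Y * Z = 5 * Z ^ 3 := by
  obtain ⟨a, rfl⟩ := hA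
  have haB : IsCoprime a B := hAB.of_mul_left_right
  have haC : IsCoprime a C := hAC.of_mul_left_right
  have h : a * B * C = R ^ 3 := by linarith
  have h3 : Odd 3 := by decide
  obtain ⟨x, rfl⟩ := Int.eq_pow_of_mul_eq_pow_odd_left (haB.mul_right haC) h3
    (by rw [← h]; ring)
  obtain ⟨y, rfl⟩ := Int.eq_pow_of_mul_eq_pow_odd_left (haB.symm.mul_right hBC) h3
    (c := R) (by rw [← h]; ring)
  obtain ⟨z, rfl⟩ := Int.eq_pow_of_mul_eq_pow_odd_left (haC.symm.mul_right hBC.symm) h3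
    (c := R) (by rw [← h]; ring)
  obtain rfl : x * y * z = R := pow_three_injective (by simp only [mul_pow, h])
  refine ⟨y, z, -x, (IsCoprime.pow_iff (by norm_num) (by norm_num)).1 hBC, ?_, ⟨-1, by ring⟩,
    by linear_combination hsum⟩
  rintro hx
  simp [neg_eq_zero.1 hx] at hR

/-- Every point of `A + B + C = 5R, ABC = 5R³` with `R ≠ 0` lifts along the 3-isogeny from the
curve `X³ + Y³ + 5XYZ = 5Z³`. -/
theorem exists_cubic_of_add_eq {A B C R : ℤ} (hR : R ≠ 0) (hsum : A + B + C = 5 * R)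
    (hprod : A * B * C = 5 * R ^ 3) :
    ∃ X Y Z : ℤ, IsCoprime X Y ∧ Z ≠ 0 ∧ X * Y * Z ∣ R ∧
      X ^ 3 + Y ^ 3 + 5 * X * Y * Z = 5 * Z ^ 3 := by
  induction hk : R.natAbs using Nat.strong_induction_on generalizing A B C R with
  | _ k ih =>
  subst hk
  by_cases hprime : ∀ p : ℤ, Prime p → p ∣ A → p ∣ B → ¬ p ∣ R
  · have hAB := isCoprime_of_add_eq hR hsum hprod hprime
    have hAC : IsCoprime A C := isCoprime_of_add_eq (B := C) (C := B) hR (by linarith)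
      (by linarith) fun p hp hA hC hpR ↦ hprime p hp hA (by
        rw [show B = 5 * R - A - C by linarith]
        exact ((hpR.mul_left 5).sub hA).sub hC) hpR
    have hBC : IsCoprime B C := isCoprime_of_add_eq (A := B) (B := C) (C := A) hR (by linarith)
      (by linarith) fun p hp hB hC hpR ↦ hprime p hp (by
        rw [show A = 5 * R - B - C by linarith]
        exact ((hpR.mul_left 5).sub hB).sub hC) hB hpR
    have h5 : Prime (5 : ℤ) := by norm_num
    have hdvd : 5 ∣ A * B * C := ⟨_, hprod⟩
    rcases h5.dvd_or_dvd hdvd with h | hC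
    · rcases h5.dvd_or_dvd h with hA | hB
      · exact exists_cubic_of_five_dvd hR hsum hprod hAB hAC hBC hA
      · exact exists_cubic_of_five_dvd hR (by linarith) (by linarith) hAB.symm hBC hAC hB
    · exact exists_cubic_of_five_dvd hR (by linarith) (by linarith) hAC.symm hBC.symm hAB hC
  · push Not at hprime
    obtain ⟨p, hp, ⟨a, rfl⟩, ⟨b, rfl⟩, ⟨r, rfl⟩⟩ := hprime
    have hr : r ≠ 0 := right_ne_zero_of_mul hR
    have hlt : r.natAbs < (p * r).natAbs := by
      rw [Int.natAbs_mul]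
      exact lt_mul_of_one_lt_left (Int.natAbs_pos.2 hr) (Int.prime_iff_natAbs_prime.1 hp).one_lt
    have hC : C = p * (5 * r - a - b) := by linear_combination hsum
    obtain ⟨X, Y, Z, hXY, hZ, hdvd, h⟩ := ih _ hlt (A := a) (B := b) (C := 5 * r - a - b) hr
      (by ring) (mul_left_cancel₀ (pow_ne_zero 3 hp.ne_zero) (by rw [hC] at hprod; linarith)) rfl
    exact ⟨X, Y, Z, hXY, hZ, hdvd.mul_left p, h⟩

theorem exists_eq_pow_of_mul_eq {w N z : ℤ} (hwN : IsCoprime w N) (hN : IsCoprime 10 N)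
    (h : w * N = 10 * z ^ 3) : ∃ r n : ℤ, w = 10 * r ^ 3 ∧ N = n ^ 3 ∧ z = r * n := by
  obtain ⟨w, rfl⟩ : 10 ∣ w := hN.dvd_of_dvd_mul_right ⟨_, h⟩
  have h' : w * N = z ^ 3 := by linarith
  have hcop : IsCoprime w N := hwN.of_mul_left_right
  obtain ⟨r, rfl⟩ := Int.eq_pow_of_mul_eq_pow_odd_left hcop (by decide : Odd 3) h'
  obtain ⟨n, rfl⟩ := Int.eq_pow_of_mul_eq_pow_odd_right hcop (by decide : Odd 3) h'
  exact ⟨r, n, rfl, rfl, pow_three_injective (by simp only [mul_pow, h'])⟩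

/-- The norm of the Eisenstein integer `(3X + 5Z) + (3Y + 5Z)ω`, a factor of
`27(X³ + Y³ + 5XYZ) - 125Z³`. -/
def factorNorm (X Y Z : ℤ) : ℤ :=
  (3 * X + 5 * Z) ^ 2 - (3 * X + 5 * Z) * (3 * Y + 5 * Z) + (3 * Y + 5 * Z) ^ 2

theorem not_two_dvd_factorNorm {X Y Z : ℤ} (hXY : IsCoprime X Y)
    (h : X ^ 3 + Y ^ 3 + 5 * X * Y * Z = 5 * Z ^ 3) : ¬ 2 ∣ factorNorm X Y Z := by
  rintro ⟨k, hk⟩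
  have key : ∀ x y z : ZMod 4, x ^ 3 + y ^ 3 + 5 * x * y * z = 5 * z ^ 3 →
      2 * ((3 * x + 5 * z) ^ 2 - (3 * x + 5 * z) * (3 * y + 5 * z) + (3 * y + 5 * z) ^ 2) = 0 →
      2 * x = 0 ∧ 2 * y = 0 := by decide
  have hk' : 2 * factorNorm X Y Z = 4 * k := by rw [hk]; ring
  have h4 : (4 : ZMod 4) = 0 := rfl
  obtain ⟨hX, hY⟩ := key X Y Z (by exact_mod_cast congrArg (Int.cast : ℤ → ZMod 4) h) (by
    have := congrArg (Int.cast : ℤ → ZMod 4) hk'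
    simp only [factorNorm] at this
    push_cast [h4] at this
    rw [this, zero_mul])
  have hX' : (4 : ℤ) ∣ 2 * X := (ZMod.intCast_zmod_eq_zero_iff_dvd _ 4).1 (by exact_mod_cast hX)
  have hY' : (4 : ℤ) ∣ 2 * Y := (ZMod.intCast_zmod_eq_zero_iff_dvd _ 4).1 (by exact_mod_cast hY)
  exact Int.prime_two.not_isUnit (hXY.isUnit_of_dvd' (by omega) (by omega))

theorem not_five_dvd_factorNorm {X Y Z : ℤ} (hXY : IsCoprime X Y)
    (h : X ^ 3 + Y ^ 3 + 5 * X * Y * Z = 5 * Z ^ 3) : ¬ 5 ∣ factorNorm X Y Z := by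
  intro hk
  have key : ∀ x y z : ZMod 5, x ^ 3 + y ^ 3 + 5 * x * y * z = 5 * z ^ 3 →
      (3 * x + 5 * z) ^ 2 - (3 * x + 5 * z) * (3 * y + 5 * z) + (3 * y + 5 * z) ^ 2 = 0 →
      x = 0 ∧ y = 0 := by decide
  obtain ⟨hX, hY⟩ := key X Y Z (by exact_mod_cast congrArg (Int.cast : ℤ → ZMod 5) h) (by
    have := (ZMod.intCast_zmod_eq_zero_iff_dvd _ 5).2 hk
    simp only [factorNorm] at this
    exact_mod_cast this)
  have hX' : (5 : ℤ) ∣ X := (ZMod.intCast_zmod_eq_zero_iff_dvd _ 5).1 hX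
  have hY' : (5 : ℤ) ∣ Y := (ZMod.intCast_zmod_eq_zero_iff_dvd _ 5).1 hY
  exact (by norm_num : Prime (5 : ℤ)).not_isUnit (hXY.isUnit_of_dvd' hX' hY')

theorem isCoprime_ten_factorNorm {X Y Z : ℤ} (hXY : IsCoprime X Y)
    (h : X ^ 3 + Y ^ 3 + 5 * X * Y * Z = 5 * Z ^ 3) : IsCoprime 10 (factorNorm X Y Z) := by
  have h2 := (Int.prime_two.coprime_iff_not_dvd).2 (not_two_dvd_factorNorm hXY h)
  have h5 := ((by norm_num : Prime (5 : ℤ)).coprime_iff_not_dvd).2 (not_five_dvd_factorNorm hXY h)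
  exact h2.mul_left h5

theorem mul_factorNorm {X Y Z : ℤ} (h : X ^ 3 + Y ^ 3 + 5 * X * Y * Z = 5 * Z ^ 3) :
    (3 * (X + Y) - 5 * Z) * factorNorm X Y Z = 10 * Z ^ 3 := by
  rw [factorNorm]; linear_combination 27 * h

theorem dvd_of_dvd_mul_pow {p N m : ℤ} (hp : Prime p) (hN : IsCoprime 10 N) (hpN : p ∣ N)
    (h : p ∣ 10 * m ^ 3) : p ∣ m := by
  rcases hp.dvd_or_dvd h with h | h
  · exact absurd (hN.isUnit_of_dvd' h hpN) hp.not_isUnit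
  · exact hp.dvd_of_dvd_pow h

/-- A residue obstruction modulo 9: the relevant unit is a cube. -/
theorem not_three_dvd_obstruction {a b r : ℤ} (hn : ¬ 3 ∣ a ^ 2 - a * b + b ^ 2) (hr : ¬ 3 ∣ r) :
    10 * r ^ 3 + 15 * (r * (a ^ 2 - a * b + b ^ 2)) ≠
        a ^ 3 + b ^ 3 - 3 * a * b ^ 2 + 3 * a * b * (a - b) ∧
      10 * r ^ 3 + 15 * (r * (a ^ 2 - a * b + b ^ 2)) ≠
        a ^ 3 + b ^ 3 - 3 * a * b ^ 2 - 2 * (3 * a * b * (a - b)) := by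
  have key : ∀ a b r : ZMod 9, 3 * (a ^ 2 - a * b + b ^ 2) ≠ 0 → 3 * r ≠ 0 →
      10 * r ^ 3 + 15 * (r * (a ^ 2 - a * b + b ^ 2)) ≠
        a ^ 3 + b ^ 3 - 3 * a * b ^ 2 + 3 * a * b * (a - b) ∧
      10 * r ^ 3 + 15 * (r * (a ^ 2 - a * b + b ^ 2)) ≠
        a ^ 3 + b ^ 3 - 3 * a * b ^ 2 - 2 * (3 * a * b * (a - b)) := by decide +kernel
  have cast_ne : ∀ m : ℤ, ¬ 3 ∣ m → 3 * (m : ZMod 9) ≠ 0 := fun m hm h ↦ by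
    have : (9 : ℤ) ∣ 3 * m := (ZMod.intCast_zmod_eq_zero_iff_dvd _ 9).1 (by exact_mod_cast h)
    omega
  have := key a b r (by exact_mod_cast cast_ne _ hn) (cast_ne _ hr)
  refine this.imp (mt fun h ↦ ?_) (mt fun h ↦ ?_) <;>
    exact_mod_cast congrArg (Int.cast : ℤ → ZMod 9) h

/-- Descent along the dual isogeny, away from 3. -/
theorem exists_add_eq_of_not_three_dvd {X Y Z : ℤ} (hXY : IsCoprime X Y) (h3 : ¬ 3 ∣ Z)
    (h : X ^ 3 + Y ^ 3 + 5 * X * Y * Z = 5 * Z ^ 3) :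
    ∃ A B C R : ℤ, R ∣ Z ∧ A + B + C = 5 * R ∧ A * B * C = 5 * R ^ 3 := by
  have hmul := mul_factorNorm h
  have hten := isCoprime_ten_factorNorm hXY h
  have hZ : Z ≠ 0 := by rintro rfl; simp at h3
  have hp3 : ∀ p : ℤ, Prime p → p ∣ Z → ∀ m, p ∣ 3 * m → p ∣ m := fun p hp hpZ m hm ↦
    (hp.dvd_or_dvd hm).resolve_left fun hp3 ↦
      h3 (((hp.associated_of_dvd Int.prime_three hp3).dvd_iff_dvd_left).1 hpZ)
  have hpq : IsCoprime (3 * X + 5 * Z) (3 * Y + 5 * Z) := by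
    refine isCoprime_of_prime_dvd ?_ fun p hp hpp hpq ↦ ?_
    · rintro ⟨h₁, h₂⟩
      simp [factorNorm, h₁, h₂, hZ] at hmul
    have hpN : p ∣ factorNorm X Y Z :=
      ((dvd_pow hpp two_ne_zero).sub (hpp.mul_right _)).add (dvd_pow hpq two_ne_zero)
    have hpZ := dvd_of_dvd_mul_pow hp hten hpN (hmul ▸ hpN.mul_left _)
    have hX := hp3 p hp hpZ X ((dvd_add_left (hpZ.mul_left 5)).1 hpp)
    have hY := hp3 p hp hpZ Y ((dvd_add_left (hpZ.mul_left 5)).1 hpq)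
    exact hp.not_isUnit (hXY.isUnit_of_dvd' hX hY)
  have hcop : IsCoprime (3 * (X + Y) - 5 * Z) (factorNorm X Y Z) := by
    refine isCoprime_of_prime_dvd ?_ fun p hp hpW hpN ↦ ?_
    · rintro ⟨h₁, -⟩
      simp [h₁, hZ] at hmul
    have hpZ := dvd_of_dvd_mul_pow hp hten hpN (hmul ▸ hpN.mul_left _)
    have hS : p ∣ X + Y := hp3 p hp hpZ _ ((dvd_sub_left (hpZ.mul_left 5)).1 hpW)
    have hX : p ∣ X := by
      refine hp.dvd_of_dvd_pow (n := 2) (hp3 p hp hpZ _ (hp3 p hp hpZ _ (hp3 p hp hpZ _ ?_)))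
      have : 3 * (3 * (3 * X ^ 2)) = factorNorm X Y Z - (X + Y) * (9 * (Y - 2 * X))
          - Z * (15 * X + 15 * Y + 25 * Z) := by
        rw [factorNorm]; ring
      rw [this]
      exact (hpN.sub (hS.mul_right _)).sub (hpZ.mul_right _)
    exact hp.not_isUnit (hXY.isUnit_of_dvd' hX ((dvd_add_right hX).1 hS))
  obtain ⟨r, n, hW, hN, rfl⟩ := exists_eq_pow_of_mul_eq hcop hten hmul
  have hn : ¬ 3 ∣ n := fun hn ↦ h3 (hn.mul_left r)
  have hr : ¬ 3 ∣ r := fun hr ↦ h3 (hr.mul_right n)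
  obtain ⟨a, b, rfl, hab⟩ := EisensteinInt.exists_cube hpq hn hN
  obtain ⟨h₁, h₂⟩ := not_three_dvd_obstruction hn hr
  rcases hab with ⟨hp, hq⟩ | ⟨hp, hq⟩ | ⟨hp, hq⟩
  · exact absurd (by linear_combination hp + hq - hW) h₁
  · exact absurd (by linear_combination hp + hq - hW) h₂
  · have hrel : 10 * r ^ 3 + 15 * (r * (a ^ 2 - a * b + b ^ 2)) =
        3 * a * b * (a - b) - 2 * (a ^ 3 + b ^ 3 - 3 * a * b ^ 2) := by
      linear_combination hp + hq - hW
    have hprod : (5 * r - 2 * a + b) * (5 * r + a + b) * (5 * r + a - 2 * b) = 135 * r ^ 3 := by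
      linear_combination -hrel
    obtain ⟨A, hA⟩ : 3 ∣ 5 * r - 2 * a + b := by
      refine Int.prime_three.dvd_of_dvd_pow (n := 3) ?_
      refine ⟨45 * r ^ 3 - (5 * r - 2 * a + b) * (a * (5 * r + a - 2 * b)
        + (a - b) * (5 * r - 2 * a + b)), ?_⟩
      linear_combination hprod
    refine ⟨A, A + a, A + a - b, r, dvd_mul_right _ _, by linarith, ?_⟩
    have h27 : 27 * (A * (A + a) * (A + a - b)) = 27 * (5 * r ^ 3) := by
      rw [show 27 * (A * (A + a) * (A + a - b)) =
        (3 * A) * (3 * A + 3 * a) * (3 * A + 3 * a - 3 * b) by ring, ← hA]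
      linear_combination hprod
    linarith

/-- The primitive solutions of `X³ + Y³ + 5XYZ = 5Z³` with `3 ∣ Z`, parametrised linearly. -/
theorem exists_parametrization {X Y Z : ℤ} (hXY : IsCoprime X Y) (h3 : 3 ∣ Z)
    (h : X ^ 3 + Y ^ 3 + 5 * X * Y * Z = 5 * Z ^ 3) :
    ∃ c w z : ℤ, X = c + 3 * w ∧ Y = 15 * z + 6 * w - c ∧ Z = 9 * z := by
  have hp := Int.prime_three
  obtain ⟨z, rfl⟩ := h3
  obtain ⟨s, hs⟩ : 3 ∣ X + Y := hp.dvd_of_dvd_pow (n := 3)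
    ⟨45 * z ^ 3 - 5 * X * Y * z + X * Y * (X + Y), by linear_combination h⟩
  obtain rfl : Y = 3 * s - X := by linarith
  have hX : ¬ 3 ∣ X := fun hX ↦
    hp.not_isUnit (hXY.isUnit_of_dvd' hX ((dvd_mul_right 3 s).sub hX))
  have hY : ¬ 3 ∣ 3 * s - X := fun hY ↦ hX (by omega)
  have hP : ∀ m, 3 ∣ X * (3 * s - X) * m → 3 ∣ m := fun m hm ↦
    (hp.dvd_or_dvd hm).resolve_left fun hm ↦ (hp.dvd_or_dvd hm).elim hX hY
  obtain ⟨z, rfl⟩ : 3 ∣ z := by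
    have : 3 ∣ 5 * z := hP _ ⟨15 * z ^ 3 - 3 * s ^ 3 + X * (3 * s - X) * s, by linarith⟩
    omega
  obtain ⟨w, hw⟩ : 3 ∣ s - 5 * z := hP _ ⟨s ^ 3 - 135 * z ^ 3, by linarith⟩
  exact ⟨X - 3 * w, w, z, by ring, by linarith, by ring⟩

theorem not_three_dvd_of_not_three_dvd {a b : ℤ} (hn : ¬ 3 ∣ a ^ 2 - a * b + b ^ 2) :
    ¬ 3 ∣ a ^ 3 + b ^ 3 - 3 * a * b ^ 2 := by
  rintro ⟨k, hk⟩
  obtain ⟨l, hl⟩ : 3 ∣ a + b := Int.prime_three.dvd_of_dvd_pow (n := 3)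
    ⟨k + a ^ 2 * b + 2 * a * b ^ 2, by linear_combination hk⟩
  exact hn ⟨l * (a + b) - a * b, by linear_combination (a + b) * hl⟩

/-- Descent along the dual isogeny, at 3. -/
theorem exists_add_eq_of_three_dvd {X Y Z : ℤ} (hXY : IsCoprime X Y) (hZ : Z ≠ 0) (h3 : 3 ∣ Z)
    (h : X ^ 3 + Y ^ 3 + 5 * X * Y * Z = 5 * Z ^ 3) :
    ∃ A B C R : ℤ, R ∣ Z ∧ A + B + C = 5 * R ∧ A * B * C = 5 * R ^ 3 := by
  have hten := isCoprime_ten_factorNorm hXY h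
  have hmul := mul_factorNorm h
  obtain ⟨c, w, z, rfl, rfl, rfl⟩ := exists_parametrization hXY h3 h
  obtain ⟨d, hd⟩ : ∃ d, d = 15 * z + 3 * w := ⟨_, rfl⟩
  have hfac : factorNorm (c + 3 * w) (15 * z + 6 * w - c) (9 * z) =
      27 * (c ^ 2 - c * d + d ^ 2) := by
    rw [factorNorm, hd]; ring
  rw [hfac] at hten hmul
  replace hten : IsCoprime 10 (c ^ 2 - c * d + d ^ 2) := hten.of_mul_right_right
  replace hmul : w * (c ^ 2 - c * d + d ^ 2) = 10 * z ^ 3 := by linarith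
  have hz : z ≠ 0 := right_ne_zero_of_mul hZ
  have hprime : ∀ p : ℤ, Prime p → p ∣ c → p ∣ 3 * w → ¬ p ∣ 15 * z := fun p hp hc hw hz ↦
    hp.not_isUnit (hXY.isUnit_of_dvd' (hc.add hw)
      (by rw [show 15 * z + 6 * w - c = 15 * z + 2 * (3 * w) - c by ring]
          exact (hz.add (hw.mul_left 2)).sub hc))
  have hcd : IsCoprime c d := by
    refine isCoprime_of_prime_dvd ?_ fun p hp hpc hpd ↦ ?_
    · rintro ⟨h₁, h₂⟩
      simp [h₁, h₂, hz] at hmul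
    have hpM : p ∣ c ^ 2 - c * d + d ^ 2 :=
      ((dvd_pow hpc two_ne_zero).sub (hpc.mul_right _)).add (dvd_pow hpd two_ne_zero)
    have hpz := (dvd_of_dvd_mul_pow hp hten hpM (hmul ▸ hpM.mul_left _)).mul_left 15
    exact hprime p hp hpc ((dvd_add_right hpz).1 (hd ▸ hpd)) hpz
  have hcop : IsCoprime w (c ^ 2 - c * d + d ^ 2) := by
    refine isCoprime_of_prime_dvd ?_ fun p hp hpw hpM ↦ ?_
    · rintro ⟨h₁, -⟩
      simp [h₁, hz] at hmul
    have hpz := (dvd_of_dvd_mul_pow hp hten hpM (hmul ▸ hpM.mul_left _)).mul_left 15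
    have hpd : p ∣ d := hd ▸ hpz.add (hpw.mul_left 3)
    refine hprime p hp (hp.dvd_of_dvd_pow (n := 2) ?_) (hpw.mul_left 3) hpz
    rw [show c ^ 2 = c ^ 2 - c * d + d ^ 2 - d * (d - c) by ring]
    exact hpM.sub (hpd.mul_right _)
  have hd3 : 3 ∣ d := ⟨5 * z + w, by linarith⟩
  have hM3 : ¬ 3 ∣ c ^ 2 - c * d + d ^ 2 := fun hM ↦ by
    have hc : 3 ∣ c := by
      refine Int.prime_three.dvd_of_dvd_pow (n := 2) ?_
      rw [show c ^ 2 = c ^ 2 - c * d + d ^ 2 - d * (d - c) by ring]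
      exact hM.sub (hd3.mul_right _)
    exact Int.prime_three.not_isUnit (hcd.isUnit_of_dvd' hc hd3)
  obtain ⟨r, n, rfl, hM, rfl⟩ := exists_eq_pow_of_mul_eq hcop hten hmul
  have hn : ¬ 3 ∣ n := fun hn ↦ hM3 (hM ▸ dvd_pow hn three_ne_zero)
  obtain ⟨a, b, rfl, hab⟩ := EisensteinInt.exists_cube hcd hn hM
  have hc₀ := not_three_dvd_of_not_three_dvd hn
  rcases hab with ⟨-, hd'⟩ | ⟨-, hd'⟩ | ⟨-, hd'⟩
  · exact ⟨b - 5 * r, a - b - 5 * r, -a - 5 * r, -3 * r,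
      ⟨-3 * (a ^ 2 - a * b + b ^ 2), by ring⟩, by ring,
      mul_left_cancel₀ three_ne_zero (by linear_combination hd' - hd)⟩
  · refine absurd ?_ hc₀
    rw [show a ^ 3 + b ^ 3 - 3 * a * b ^ 2 = d + 3 * (a * b * (a - b)) by linarith]
    exact hd3.add (dvd_mul_right _ _)
  · refine absurd ?_ hc₀
    rw [show a ^ 3 + b ^ 3 - 3 * a * b ^ 2 = -d by linarith]
    exact hd3.neg_right

theorem eq_zero_of_cubic {X Y Z : ℤ} (hXY : IsCoprime X Y)
    (h : X ^ 3 + Y ^ 3 + 5 * X * Y * Z = 5 * Z ^ 3) : Z = 0 := by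
  induction hk : Z.natAbs using Nat.strong_induction_on generalizing X Y Z with
  | _ k ih =>
  subst hk
  by_contra hZ
  obtain ⟨A, B, C, R, hRZ, hsum, hprod⟩ :
      ∃ A B C R : ℤ, R ∣ Z ∧ A + B + C = 5 * R ∧ A * B * C = 5 * R ^ 3 := by
    by_cases h3 : 3 ∣ Z
    · exact exists_add_eq_of_three_dvd hXY hZ h3 h
    · exact exists_add_eq_of_not_three_dvd hXY h3 h
  have hR : R ≠ 0 := ne_zero_of_dvd_ne_zero hZ hRZ
  obtain ⟨x, y, z, hxy, hz, hdvd, h'⟩ := exists_cubic_of_add_eq hR hsum hprod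
  obtain ⟨m, hm⟩ := hdvd.trans hRZ
  by_cases hunit : IsUnit (x * y)
  · obtain ⟨hx, hy⟩ := IsUnit.mul_iff.1 hunit
    have hz2 : z ^ 2 + 1 ≠ 0 := by positivity
    rcases Int.isUnit_iff.1 hx with rfl | rfl <;> rcases Int.isUnit_iff.1 hy with rfl | rfl
    · omega
    · exact mul_ne_zero hz hz2 (by linarith)
    · exact mul_ne_zero hz hz2 (by linarith)
    · omega
  · refine hz (ih _ ?_ hxy h' rfl)
    have hxym : ¬ IsUnit (x * y * m) := fun hu ↦ hunit (isUnit_of_mul_isUnit_left hu)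
    have hZ' : Z = z * (x * y * m) := by rw [hm]; ring
    have h0 : x * y * m ≠ 0 := right_ne_zero_of_mul (hZ' ▸ hZ)
    rw [Int.isUnit_iff_natAbs_eq] at hxym
    rw [hZ', Int.natAbs_mul]
    exact lt_mul_of_one_lt_right (Int.natAbs_pos.2 hz) (by omega)

theorem eq_zero_of_add_eq {A B C R : ℤ} (hsum : A + B + C = 5 * R)
    (hprod : A * B * C = 5 * R ^ 3) : R = 0 := by
  by_contra hR
  obtain ⟨X, Y, Z, hXY, hZ, -, h⟩ := exists_cubic_of_add_eq hR hsum hprod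
  exact hZ (eq_zero_of_cubic hXY h)

end Curve50a3


/-- The only rational solutions of `v² + 5u³ + 5u² + 4 = 0` are `(u, v) = (-2, ±4)`:
the Mordell–Weil group of the elliptic curve 50.a3 over `ℚ` consists of the point at
infinity together with these two points, so it has order 3. -/
theorem rational_points_50a3 (u v : ℚ) :
    v ^ 2 + 5 * u ^ 3 + 5 * u ^ 2 + 4 = 0 ↔ u = -2 ∧ (v = 4 ∨ v = -4) := by
  constructor
  · intro h
    have hu : u = -2 := by
      obtain ⟨a, b, d, hd, rfl, rfl⟩ : ∃ a b d : ℤ, (d : ℚ) ≠ 0 ∧ u = a / d ∧ v = b / d := by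
        have hu : (u.den : ℚ) ≠ 0 := Nat.cast_ne_zero.2 u.den_nz
        have hv : (v.den : ℚ) ≠ 0 := Nat.cast_ne_zero.2 v.den_nz
        refine ⟨u.num * v.den, v.num * u.den, u.den * v.den, by simp, ?_, ?_⟩ <;>
          push_cast <;> rw [eq_div_iff (mul_ne_zero hu hv)]
        · linear_combination (v.den : ℚ) * Rat.mul_den_eq_num u
        · linear_combination (u.den : ℚ) * Rat.mul_den_eq_num v
      field_simp at h
      have h' : b ^ 2 * d + 5 * a ^ 3 + 5 * a ^ 2 * d + 4 * d ^ 3 = 0 := by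
        have : (b ^ 2 * d + 5 * a ^ 3 + 5 * a ^ 2 * d + 4 * d ^ 3 : ℚ) = 0 := by
          linear_combination h
        exact_mod_cast this
      have hR : 2 * (a + 2 * d) = 0 := Curve50a3.eq_zero_of_add_eq
        (A := 8 * d) (B := 5 * a + 6 * d + b) (C := 5 * a + 6 * d - b) (by ring)
        (by linear_combination -8 * h')
      have hR' : (a : ℚ) = -2 * d := by exact_mod_cast (by linarith : a = -2 * d)
      rw [hR', mul_div_assoc, div_self hd, mul_one]
    subst hu
    refine ⟨rfl, sq_eq_sq_iff_eq_or_eq_neg.1 ?_⟩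
    linear_combination h
  · rintro ⟨rfl, rfl | rfl⟩ <;> norm_num
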